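/- Let M, N be positive integers, x, y : Fin M → ℝ (samples), and p : Fin N → ℝ (exponents). Define φ(q) = max_{k} (q * x k − y k) and Δ(p) = max_{i} (y i − max_{j} (p j * x i − φ(p j))). Define the coefficient vector θ : Fin N → ℝ by θ j = Δ(p)/2 − φ(p j). Then max_{i} |max_{j} (θ j + p j * x i) − y i| = Δ(p)/2. -/

import Mathlib

open Finset

/-- Adding a constant commutes with taking a finite maximum. -/
theorem sup'_const_add {ι : Type*} {s : Finset ι} (hs : s.Nonempty) (c : ℝ) (f : ι → ℝ) :
    (s.sup' hs fun j => c + f j) = c + s.sup' hs f := by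
  apply le_antisymm
  · exact sup'_le _ _ fun j hj => by gcongr; exact le_sup' f hj
  · obtain ⟨j, hj, h⟩ := exists_mem_eq_sup' hs f
    rw [h]
    exact le_sup' (fun j => c + f j) hj

/-- Shifting nonnegative deviations by half of their maximum yields maximal absolute deviation
equal to that half. -/
theorem sup'_abs_half_sup'_sub {ι : Type*} {s : Finset ι} (hs : s.Nonempty) {d : ι → ℝ}
    (hd : ∀ i ∈ s, 0 ≤ d i) :
    (s.sup' hs fun i => |s.sup' hs d / 2 - d i|) = s.sup' hs d / 2 := by
  obtain ⟨i, hi, h⟩ := exists_mem_eq_sup' hs d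
  apply le_antisymm
  · refine sup'_le _ _ fun k hk => abs_le.mpr ⟨?_, ?_⟩
    · linarith [le_sup' d hk]
    · linarith [hd k hk]
  · refine le_trans ?_ (le_sup' (fun i => |s.sup' hs d / 2 - d i|) hi)
    rw [← h]
    exact le_trans (by linarith) (neg_le_abs _)

/-- The coefficient vector `θ j = Δ(p)/2 − φ(p j)`, with
`φ(q) = max_k (q * x k − y k)`, attains the best Chebyshev approximation error
`Δ(p)/2` between the max-plus polynomial values at the sample points and the
sample outputs. -/
theorem maxplus_best_coefficients {M N : ℕ} (hM : 0 < M) (hN : 0 < N)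
    (x y : Fin M → ℝ) (p : Fin N → ℝ) :
    haveI : Nonempty (Fin M) := ⟨⟨0, hM⟩⟩
    haveI : Nonempty (Fin N) := ⟨⟨0, hN⟩⟩
    let φ : ℝ → ℝ := fun q => univ.sup' univ_nonempty fun k => q * x k - y k
    let Δ : ℝ := univ.sup' univ_nonempty fun i =>
      y i - univ.sup' univ_nonempty fun j => p j * x i - φ (p j)
    let θ : Fin N → ℝ := fun j => Δ / 2 - φ (p j)
    (univ.sup' univ_nonempty fun i =>
      |(univ.sup' univ_nonempty fun j => θ j + p j * x i) - y i|) = Δ / 2 := by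
  intro φ Δ θ
  have : Nonempty (Fin M) := ⟨⟨0, hM⟩⟩
  have : Nonempty (Fin N) := ⟨⟨0, hN⟩⟩
  let g : Fin M → ℝ := fun i => univ.sup' univ_nonempty fun j => p j * x i - φ (p j)
  have hg : ∀ i ∈ univ, 0 ≤ y i - g i := fun i hi => by
    refine sub_nonneg.mpr (sup'_le _ _ fun j _ => ?_)
    linarith [le_sup' (fun k => p j * x k - y k) hi]
  have hθ : ∀ i, (univ.sup' univ_nonempty fun j => θ j + p j * x i) = Δ / 2 + g i := fun i => by
    rw [← sup'_const_add]
    congr 1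
    ext j
    simp only [θ]
    ring
  simp only [hθ, add_sub_assoc, ← neg_sub (y _) (g _), ← sub_eq_add_neg]
  exact sup'_abs_half_sup'_sub univ_nonempty hg
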